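/- arXiv:2205.03992 — 2 statements merged into one kernel-verified Lean document; each statement's English description precedes it below -/
import Mathlib

section
/- Let ℱ be a pure sheaf on a fan Δ. For every open set U (subfan of Δ) and every integer r, one has 𝔪·𝒲^{r−2}ℱ(U) ⊆ 𝒲^rℱ(U), where 𝔪 = (x_1,…,x_d) is the homogeneous maximal ideal of A = ℝ[x_1,…,x_d]. -/
open scoped Classical

noncomputable section

/-! ### Cones and fans -/

abbrev Vec (d : ℕ) := Fin d → ℝ

abbrev PolyA (d : ℕ) := MvPolynomial (Fin d) ℝ

/-- A (polyhedral) cone in `ℝ^d`: the set of nonnegative combinations of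
finitely many vectors. -/
def IsPolyCone {d : ℕ} (σ : Set (Vec d)) : Prop :=
  ∃ (n : ℕ) (v : Fin n → Vec d),
    σ = {x | ∃ c : Fin n → ℝ, (∀ i, 0 ≤ c i) ∧ x = ∑ i, c i • v i}

/-- A pointed cone: a polyhedral cone containing no line through the origin. -/
def IsPointedCone {d : ℕ} (σ : Set (Vec d)) : Prop :=
  IsPolyCone σ ∧ ∀ x ∈ σ, -x ∈ σ → x = 0

/-- `τ` is a face of the cone `σ`: it is cut out of `σ` by a linear form that is
nonnegative on `σ`. -/
def IsFaceOf {d : ℕ} (τ σ : Set (Vec d)) : Prop :=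
  ∃ w : Vec d →ₗ[ℝ] ℝ, (∀ x ∈ σ, 0 ≤ w x) ∧ τ = {x ∈ σ | w x = 0}

/-- A fan in `ℝ^d`: a finite collection of pointed cones, closed under taking faces,
such that the intersection of two cones is a face of both. -/
structure Fan (d : ℕ) where
  cones : Set (Set (Vec d))
  finite : cones.Finite
  pointed : ∀ σ ∈ cones, IsPointedCone σ
  faceClosed : ∀ σ ∈ cones, ∀ τ, IsFaceOf τ σ → τ ∈ cones
  interFace : ∀ σ ∈ cones, ∀ τ ∈ cones, IsFaceOf (σ ∩ τ) σ

/-- The dimension of a cone. -/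
def coneDim {d : ℕ} (σ : Set (Vec d)) : ℕ := Module.finrank ℝ (Submodule.span ℝ σ)

/-- The zero cone. -/
def oCone (d : ℕ) : Set (Vec d) := {0}

/-- The dimension of a collection of cones. -/
def fandim {d : ℕ} (S : Set (Set (Vec d))) : ℕ := sSup (coneDim '' S)

def Fan.support {d : ℕ} (Δ : Fan d) : Set (Vec d) := ⋃₀ Δ.cones

/-- A subfan (= open subset in the fan topology) of a fan. -/
def Subfan {d : ℕ} (Δ : Fan d) (U : Set (Set (Vec d))) : Prop :=
  U ⊆ Δ.cones ∧ ∀ σ ∈ U, ∀ τ, IsFaceOf τ σ → τ ∈ U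

/-- A face-closed subcollection of a collection of cones. -/
def FaceClosedIn {d : ℕ} (C S : Set (Set (Vec d))) : Prop :=
  S ⊆ C ∧ ∀ σ ∈ S, ∀ τ, IsFaceOf τ σ → τ ∈ S

/-- The fan `⟨σ⟩` generated by a cone: all its faces. -/
def faces {d : ℕ} (σ : Set (Vec d)) : Set (Set (Vec d)) := {τ | IsFaceOf τ σ}

/-- The boundary fan `∂σ` of a cone: all its proper faces. -/
def properFaces {d : ℕ} (σ : Set (Vec d)) : Set (Set (Vec d)) :=
  {τ | IsFaceOf τ σ ∧ τ ≠ σ}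

/-- The maximal cones of a collection of cones. -/
def maxIn {d : ℕ} (S : Set (Set (Vec d))) : Set (Set (Vec d)) :=
  {σ | σ ∈ S ∧ ∀ τ ∈ S, σ ⊆ τ → σ = τ}

/-- The non-maximal cones contained in exactly one maximal cone. -/
def bdryGensIn {d : ℕ} (S : Set (Set (Vec d))) : Set (Set (Vec d)) :=
  {σ | σ ∈ S ∧ σ ∉ maxIn S ∧ ∃! τ, τ ∈ maxIn S ∧ σ ⊆ τ}

/-- The boundary of a collection of cones: the subfan generated by the non-maximal
cones contained in exactly one maximal cone. -/
def bdryIn {d : ℕ} (S : Set (Set (Vec d))) : Set (Set (Vec d)) :=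
  {τ | ∃ σ ∈ bdryGensIn S, IsFaceOf τ σ}

/-- The boundary fan `∂Δ` of a fan `Δ`. -/
def Fan.boundary {d : ℕ} (Δ : Fan d) : Set (Set (Vec d)) := bdryIn Δ.cones

/-- A purely `n`-dimensional fan: all maximal cones have dimension `n`. -/
def PurelyDim {d : ℕ} (Δ : Fan d) (n : ℕ) : Prop :=
  ∀ σ ∈ maxIn Δ.cones, coneDim σ = n

/-- `Sg` is a refinement of `Δ`. -/
def Refines {d : ℕ} (Sg Δ : Fan d) : Prop :=
  Sg.support = Δ.support ∧ ∀ γ ∈ Sg.cones, ∃ τ ∈ Δ.cones, γ ⊆ τ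

/-- The image `π(γ)` of a cone under the fan subdivision `π : Sg → Δ`: the smallest
cone of `Δ` containing it. -/
def πmap {d : ℕ} (Δ : Fan d) (γ : Set (Vec d)) : Set (Vec d) :=
  ⋂₀ {τ | τ ∈ Δ.cones ∧ γ ⊆ τ}

/-- The preimage fan `π⁻¹(⟨τ⟩)` of the fan subdivision `π : Sg → Δ`. -/
def preim {d : ℕ} (Sg : Fan d) (τ : Set (Vec d)) : Set (Set (Vec d)) :=
  {γ | γ ∈ Sg.cones ∧ γ ⊆ τ}

lemma preim_mono {d : ℕ} (Sg : Fan d) {τ' τ : Set (Vec d)} (h : τ' ⊆ τ) :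
    preim Sg τ' ⊆ preim Sg τ := fun γ hγ => ⟨hγ.1, hγ.2.trans h⟩

/-! ### Graded modules and sheaves on fans -/

/-- The homogeneous maximal ideal `𝔪 = (x_1, …, x_d)` of `A = ℝ[x_1, …, x_d]`. -/
def mId (d : ℕ) : Ideal (PolyA d) := Ideal.span (Set.range MvPolynomial.X)

/-- The ideal of polynomial functions vanishing on the linear span of `σ`.
A module over `A_σ` (polynomial functions on `Span σ`) is the same as an `A`-module
annihilated by this ideal. -/
def vanishingIdeal {d : ℕ} (σ : Set (Vec d)) : Set (PolyA d) :=
  {p | ∀ x ∈ Submodule.span ℝ σ, MvPolynomial.eval x p = 0}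

/-- The data of a sheaf of `ℤ_{≥0}`-graded `𝒜`-modules on a fan in `ℝ^d`:
a stalk at each cone, an action of `A = ℝ[x_1, …, x_d]` on each stalk, a grading on
each stalk, and restriction maps.  The sheaf axioms are packaged in `IsSheafOn`. -/
structure SheafData (d : ℕ) where
  stalk : Set (Vec d) → Type
  [acg : ∀ σ, AddCommGroup (stalk σ)]
  [modR : ∀ σ, Module ℝ (stalk σ)]
  asmul : ∀ σ, PolyA d → stalk σ → stalk σ
  deg : ∀ σ, ℕ → Submodule ℝ (stalk σ)
  res : ∀ σ τ, stalk σ →ₗ[ℝ] stalk τ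

attribute [instance] SheafData.acg SheafData.modR

variable {d : ℕ}

/-- The sections of `F` over a collection of cones `S` (a subfan, i.e. an open set):
compatible families of stalk elements. -/
def secs (F : SheafData d) (S : Set (Set (Vec d))) :
    Submodule ℝ (∀ σ : S, F.stalk σ.1) where
  carrier := {f | ∀ (σ τ : S), IsFaceOf τ.1 σ.1 → F.res σ.1 τ.1 (f σ) = f τ}
  add_mem' := by
    intro a b ha hb σ τ h
    simp only [Pi.add_apply, map_add, ha σ τ h, hb σ τ h]
  zero_mem' := by
    intro σ τ h
    simp only [Pi.zero_apply, map_zero]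
  smul_mem' := by
    intro c a ha σ τ h
    simp only [Pi.smul_apply, map_smul, ha σ τ h]

lemma mem_secs (F : SheafData d) (S : Set (Set (Vec d))) (f : ∀ σ : S, F.stalk σ.1) :
    f ∈ secs F S ↔ ∀ (σ τ : S), IsFaceOf τ.1 σ.1 → F.res σ.1 τ.1 (f σ) = f τ :=
  Iff.rfl

/-- The submodule `𝔪·ℱ(S)` of the module of sections. -/
def mSecs (F : SheafData d) (S : Set (Set (Vec d))) : Submodule ℝ ↥(secs F S) :=
  Submodule.span ℝ {y | ∃ p ∈ mId d, ∃ z : ↥(secs F S),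
    (y : ∀ σ : S, F.stalk σ.1) = fun σ => F.asmul σ.1 p (z.1 σ)}

/-- The reduction `ℱ(S)‾ = ℱ(S)/𝔪ℱ(S)`. -/
def bar (F : SheafData d) (S : Set (Set (Vec d))) := ↥(secs F S) ⧸ mSecs F S

instance (F : SheafData d) (S : Set (Set (Vec d))) : AddCommGroup (bar F S) := by
  unfold bar; infer_instance

instance (F : SheafData d) (S : Set (Set (Vec d))) : Module ℝ (bar F S) := by
  unfold bar; infer_instance

/-- The quotient map `ρ : ℱ(S) → ℱ(S)‾`. -/
def barQ (F : SheafData d) (S : Set (Set (Vec d))) : ↥(secs F S) →ₗ[ℝ] bar F S :=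
  (mSecs F S).mkQ

/-- The degree-`n` part of the module of sections. -/
def degSec (F : SheafData d) (S : Set (Set (Vec d))) (n : ℕ) :
    Submodule ℝ ↥(secs F S) :=
  Submodule.comap (secs F S).subtype (Submodule.pi Set.univ fun σ => F.deg σ.1 n)

/-- The Poincaré polynomial `P(ℱ(S)‾ ; t)`. -/
def PPoly (F : SheafData d) (S : Set (Set (Vec d))) : Polynomial ℝ :=
  ∑ᶠ n : ℕ, Polynomial.monomial n
    ((Module.finrank ℝ ↥((degSec F S n).map (barQ F S))) : ℝ)

/-- The sheaf axioms for the data `F` on the fan `Δ`: the `A`-action is an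
`A`-module structure compatible with the real scalars and annihilated by functions
vanishing on the span of the cone (so each stalk is a module over `A_σ`), the
restriction maps are graded `A`-module maps, and the grading makes each stalk a
`ℤ_{≥0}`-graded module. -/
structure IsSheafOn (F : SheafData d) (Δ : Fan d) : Prop where
  asmul_one : ∀ σ ∈ Δ.cones, ∀ x, F.asmul σ 1 x = x
  asmul_mul : ∀ σ ∈ Δ.cones, ∀ p q x, F.asmul σ (p * q) x = F.asmul σ p (F.asmul σ q x)
  asmul_add : ∀ σ ∈ Δ.cones, ∀ p q x, F.asmul σ (p + q) x = F.asmul σ p x + F.asmul σ q x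
  asmul_dist : ∀ σ ∈ Δ.cones, ∀ p x y, F.asmul σ p (x + y) = F.asmul σ p x + F.asmul σ p y
  asmul_const : ∀ σ ∈ Δ.cones, ∀ (r : ℝ) x, F.asmul σ (MvPolynomial.C r) x = r • x
  annih : ∀ σ ∈ Δ.cones, ∀ p ∈ vanishingIdeal σ, ∀ x, F.asmul σ p x = 0
  res_self : ∀ σ ∈ Δ.cones, ∀ x, F.res σ σ x = x
  res_comp : ∀ σ ∈ Δ.cones, ∀ τ γ, IsFaceOf τ σ → IsFaceOf γ τ → ∀ x,
    F.res τ γ (F.res σ τ x) = F.res σ γ x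
  res_asmul : ∀ σ ∈ Δ.cones, ∀ τ, IsFaceOf τ σ → ∀ p x,
    F.res σ τ (F.asmul σ p x) = F.asmul τ p (F.res σ τ x)
  deg_internal : ∀ σ ∈ Δ.cones, DirectSum.IsInternal (F.deg σ)
  deg_asmul : ∀ σ ∈ Δ.cones, ∀ (i n : ℕ) (p : PolyA d), p.IsHomogeneous i →
    ∀ x ∈ F.deg σ n, F.asmul σ p x ∈ F.deg σ (n + i)
  res_deg : ∀ σ ∈ Δ.cones, ∀ τ, IsFaceOf τ σ → ∀ n, ∀ x ∈ F.deg σ n,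
    F.res σ τ x ∈ F.deg τ n

/-- Flabbiness: every restriction map between section modules is surjective. -/
def Flabby (F : SheafData d) (Δ : Fan d) : Prop :=
  ∀ U V : Set (Set (Vec d)), Subfan Δ U → Subfan Δ V → ∀ hVU : V ⊆ U,
    ∀ f ∈ secs F V, ∃ g ∈ secs F U, ∀ τ : V, g ⟨τ.1, hVU τ.2⟩ = f τ

/-- The stalk at `σ` is a finitely generated free `A_σ`-module with a homogeneous
basis. -/
def FreeStalk (F : SheafData d) (σ : Set (Vec d)) : Prop :=
  ∃ (n : ℕ) (m : Fin n → F.stalk σ) (j : Fin n → ℕ),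
    (∀ i, m i ∈ F.deg σ (j i)) ∧
    (∀ x : F.stalk σ, ∃ a : Fin n → PolyA d, x = ∑ i, F.asmul σ (a i) (m i)) ∧
    (∀ a : Fin n → PolyA d,
      (∑ i, F.asmul σ (a i) (m i)) = 0 ↔ ∀ i, a i ∈ vanishingIdeal σ)

/-- A pure sheaf on a fan: a flabby sheaf of `ℤ_{≥0}`-graded `𝒜`-modules whose
stalks are finitely generated free modules. -/
def IsPureOn (F : SheafData d) (Δ : Fan d) : Prop :=
  IsSheafOn F Δ ∧ Flabby F Δ ∧ ∀ σ ∈ Δ.cones, FreeStalk F σ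

/-- The submodule `𝔪·ℱ(σ)` of a stalk. -/
def mStalk (F : SheafData d) (σ : Set (Vec d)) : Submodule ℝ (F.stalk σ) :=
  Submodule.span ℝ {y | ∃ p ∈ mId d, ∃ z, y = F.asmul σ p z}

/-- The combined restriction map from a stalk to the product of the stalks on the
boundary fan `∂σ`. -/
def resFam (F : SheafData d) (σ : Set (Vec d)) :
    F.stalk σ →ₗ[ℝ] (∀ τ : properFaces σ, F.stalk τ.1) :=
  LinearMap.pi fun τ => F.res σ τ.1

/-- `𝔪·ℱ(∂σ)`, viewed inside the ambient product of the boundary stalks. -/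
def mBdry (F : SheafData d) (σ : Set (Vec d)) :
    Submodule ℝ (∀ τ : properFaces σ, F.stalk τ.1) :=
  (mSecs F (properFaces σ)).map (secs F (properFaces σ)).subtype

/-- The induced map `ℱ(σ)‾ → ℱ(∂σ)‾` is bijective. -/
def BarResBij (F : SheafData d) (σ : Set (Vec d)) : Prop :=
  (∀ f ∈ secs F (properFaces σ), ∃ x : F.stalk σ,
      ∃ m' ∈ mBdry F σ, ∀ τ : properFaces σ, F.res σ τ.1 x = f τ + m' τ) ∧
  (∀ x : F.stalk σ, resFam F σ x ∈ mBdry F σ → x ∈ mStalk F σ)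

/-- `F` is (isomorphic to) the shifted simple sheaf `ℒ_{σ₀}[−j]` based at `σ₀`:
it is pure, its stalk at `σ₀` is free of rank one over `A_{σ₀}` on a generator of
degree `j`, it vanishes on the other cones of dimension at most `dim σ₀`, and the
restriction maps induce isomorphisms `ℱ(τ)‾ ≅ ℱ(∂τ)‾` above `σ₀`. -/
def IsShiftedSimple (F : SheafData d) (Δ : Fan d) (σ₀ : Set (Vec d)) (j : ℕ) : Prop :=
  IsPureOn F Δ ∧
  (∃ m : F.stalk σ₀, m ∈ F.deg σ₀ j ∧ (∀ x, ∃ a : PolyA d, x = F.asmul σ₀ a m) ∧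
     ∀ a : PolyA d, F.asmul σ₀ a m = 0 ↔ a ∈ vanishingIdeal σ₀) ∧
  (∀ τ ∈ Δ.cones, coneDim τ ≤ coneDim σ₀ → τ ≠ σ₀ → ∀ x : F.stalk τ, x = 0) ∧
  (∀ τ ∈ Δ.cones, coneDim σ₀ < coneDim τ → BarResBij F τ)

/-- The simple sheaf `ℒ_{σ₀}` based at `σ₀`. -/
def IsSimple (F : SheafData d) (Δ : Fan d) (σ₀ : Set (Vec d)) : Prop :=
  IsShiftedSimple F Δ σ₀ 0

/-- The minimal extension sheaf `ℒ_Δ`: the simple sheaf based at the zero cone. -/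
def IsMinExt (F : SheafData d) (Δ : Fan d) : Prop := IsSimple F Δ (oCone d)

/-- A quasi-convex fan, via the characterization of Barthel–Brasselet–Fieseler–Kaup:
a purely `d`-dimensional fan in `ℝ^d` such that the module of global sections of
every pure sheaf is a free `A`-module. -/
def QuasiConvex (Δ : Fan d) : Prop :=
  PurelyDim Δ d ∧ ∀ F : SheafData d, IsPureOn F Δ →
    ∃ (n : ℕ) (m : Fin n → ↥(secs F Δ.cones)),
      (∀ x : ↥(secs F Δ.cones), ∃ a : Fin n → PolyA d,
        (x : ∀ σ : Δ.cones, F.stalk σ.1) = fun σ => ∑ i, F.asmul σ.1 (a i) ((m i).1 σ)) ∧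
      (∀ a : Fin n → PolyA d,
        ((fun σ : Δ.cones => ∑ i, F.asmul σ.1 (a i) ((m i).1 σ))
            = (0 : ∀ σ : Δ.cones, F.stalk σ.1)) → ∀ i, a i = 0)

/-! ### Local Poincaré polynomials -/

/-- `K_σ`, before reduction: the elements of the stalk whose restriction to the
boundary lies in `𝔪·ℱ(∂σ)`. -/
def Kpre (F : SheafData d) (σ : Set (Vec d)) : Submodule ℝ (F.stalk σ) :=
  (mBdry F σ).comap (resFam F σ)

/-- `K_σ = ker(ℱ(σ)‾ → ℱ(∂σ)‾)`. -/
def Kbar (F : SheafData d) (σ : Set (Vec d)) :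
    Submodule ℝ (F.stalk σ ⧸ mStalk F σ) :=
  (Kpre F σ).map (mStalk F σ).mkQ

/-- The degree-`i` part of `ℱ(σ)‾`. -/
def stalkDegBar (F : SheafData d) (σ : Set (Vec d)) (i : ℕ) :
    Submodule ℝ (F.stalk σ ⧸ mStalk F σ) :=
  (F.deg σ i).map (mStalk F σ).mkQ

/-- The local Poincaré polynomial `L(ℱ, σ; t) = P(K_σ; t)`. -/
def LPoly (F : SheafData d) (σ : Set (Vec d)) : Polynomial ℝ :=
  ∑ᶠ i : ℕ, Polynomial.monomial i
    ((Module.finrank ℝ ↥(Kbar F σ ⊓ stalkDegBar F σ i)) : ℝ)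

/-! ### Direct images -/

/-- Restriction of sections along an inclusion of subfans. -/
def restrSec (F : SheafData d) {S₁ S₂ : Set (Set (Vec d))} (h : S₂ ⊆ S₁) :
    ↥(secs F S₁) →ₗ[ℝ] ↥(secs F S₂) := by
  refine LinearMap.codRestrict (secs F S₂)
    ((LinearMap.pi fun σ : S₂ => LinearMap.proj (⟨σ.1, h σ.2⟩ : S₁)).comp
      (secs F S₁).subtype) ?_
  intro f
  rw [mem_secs]
  intro σ τ hface
  exact (mem_secs F S₁ f.1).mp f.2 ⟨σ.1, h σ.2⟩ ⟨τ.1, h τ.2⟩ hface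

/-- The `A`-action on the direct image stalks. -/
def pfAsmul (Sg : Fan d) (F : SheafData d) (τ : Set (Vec d)) (p : PolyA d)
    (f : ↥(secs F (preim Sg τ))) : ↥(secs F (preim Sg τ)) :=
  if h : (fun γ : preim Sg τ => F.asmul γ.1 p (f.1 γ)) ∈ secs F (preim Sg τ)
  then ⟨_, h⟩ else 0

/-- The direct image sheaf `π_*F` on `Δ` of a sheaf `F` on the refinement `Sg`
under the fan subdivision `π : Sg → Δ`. -/
def pushforward (Sg : Fan d) (F : SheafData d) : SheafData d where
  stalk τ := ↥(secs F (preim Sg τ))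
  acg := fun _ => inferInstance
  modR := fun _ => inferInstance
  asmul := pfAsmul Sg F
  deg τ n := Submodule.comap (secs F (preim Sg τ)).subtype
    (Submodule.pi Set.univ fun γ => F.deg γ.1 n)
  res τ τ' := if h : τ' ⊆ τ then restrSec F (preim_mono Sg h) else 0

/-! ### Weight sheaves and filtrations -/

/-- The subspace `𝔪·N` for a subspace `N` of a stalk. -/
def mSmul (F : SheafData d) (σ : Set (Vec d)) (N : Submodule ℝ (F.stalk σ)) :
    Submodule ℝ (F.stalk σ) :=
  Submodule.span ℝ {y | ∃ p ∈ mId d, ∃ z ∈ N, y = F.asmul σ p z}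

/-- `Wk` is the family of weight sheaves `𝒲^r F`: `Wk r σ = F(σ)` for `r ≤ 0`;
`Wk r σ = res⁻¹(𝒲^r F(∂σ))` for `0 < r ≤ dim σ`; and `Wk r σ = 𝔪·Wk (r−2) σ`
for `r > dim σ`.  (These clauses determine the family uniquely on the fan.) -/
def IsWeightFamily (F : SheafData d) (Δ : Fan d)
    (Wk : ℤ → ∀ σ : Set (Vec d), Submodule ℝ (F.stalk σ)) : Prop :=
  ∀ σ ∈ Δ.cones, ∀ r : ℤ,
    (r ≤ 0 → Wk r σ = ⊤) ∧
    (0 < r → r ≤ (coneDim σ : ℤ) →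
      ∀ x, x ∈ Wk r σ ↔ ∀ τ ∈ properFaces σ, F.res σ τ x ∈ Wk r τ) ∧
    ((coneDim σ : ℤ) < r → Wk r σ = mSmul F σ (Wk (r - 2) σ))

/-- The sections of the weight subsheaf `𝒲^r F` over `S`. -/
def WSec (F : SheafData d) (S : Set (Set (Vec d)))
    (Wk : ℤ → ∀ σ : Set (Vec d), Submodule ℝ (F.stalk σ)) (r : ℤ) :
    Submodule ℝ ↥(secs F S) :=
  Submodule.comap (secs F S).subtype (Submodule.pi Set.univ fun σ => Wk r σ.1)

/-- The (increasing) Hodge filtration `F_p` on `ℱ(S)‾`. -/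
def Ffil (F : SheafData d) (S : Set (Set (Vec d))) (p : ℤ) :
    Submodule ℝ (bar F S) :=
  ⨆ (n : ℕ) (_ : (n : ℤ) ≤ p), (degSec F S n).map (barQ F S)

/-- The (decreasing) weight filtration `W^r = ρ(𝒲^r ℱ(S))` on `ℱ(S)‾`. -/
def Wfil (F : SheafData d) (S : Set (Set (Vec d)))
    (Wk : ℤ → ∀ σ : Set (Vec d), Submodule ℝ (F.stalk σ)) (r : ℤ) :
    Submodule ℝ (bar F S) :=
  (WSec F S Wk r).map (barQ F S)

/-- The monodromy weight filtration `M^r = ρ((π_* 𝒲^r ℱ)(S))` on the reduction of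
the sections of the direct image sheaf, where the weight sheaves are taken on the
source fan `Sg`. -/
def Mfil (Sg : Fan d) (F : SheafData d)
    (Wk : ℤ → ∀ σ : Set (Vec d), Submodule ℝ (F.stalk σ))
    (S : Set (Set (Vec d))) (r : ℤ) :
    Submodule ℝ (bar (pushforward Sg F) S) :=
  (Submodule.comap (secs (pushforward Sg F) S).subtype
    (Submodule.pi Set.univ fun τ : S =>
      (Submodule.comap (secs F (preim Sg τ.1)).subtype
        (Submodule.pi Set.univ fun γ : preim Sg τ.1 => Wk r γ.1) :
        Submodule ℝ ((pushforward Sg F).stalk τ.1)))).map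
    (barQ (pushforward Sg F) S)

/-! ### Hodge–Deligne polynomials -/

/-- The dimension of the quotient of the subspace `S'` by (its intersection with)
`T`. -/
def grQ {V : Type} [AddCommGroup V] [Module ℝ V] (S' T : Submodule ℝ V) : ℕ :=
  Module.finrank ℝ (↥S' ⧸ (T.comap S'.subtype))

/-- `dim Gr^F_p Gr_W^r` for an increasing filtration `Ff` and a decreasing
filtration `Wf`. -/
def grDim2 {V : Type} [AddCommGroup V] [Module ℝ V]
    (Ff Wf : ℤ → Submodule ℝ V) (p r : ℤ) : ℕ :=
  grQ (Ff p ⊓ Wf r) ((Ff (p - 1) ⊓ Wf r) ⊔ (Ff p ⊓ Wf (r + 1)))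

/-- `dim Gr^F_p Gr_M^m Gr_W^r` for an increasing filtration `Ff` and decreasing
filtrations `Mf`, `Wf`. -/
def grDim3 {V : Type} [AddCommGroup V] [Module ℝ V]
    (Ff Mf Wf : ℤ → Submodule ℝ V) (p m r : ℤ) : ℕ :=
  grQ (Ff p ⊓ Mf m ⊓ Wf r)
    ((Ff (p - 1) ⊓ Mf m ⊓ Wf r) ⊔ (Ff p ⊓ Mf (m + 1) ⊓ Wf r) ⊔
      (Ff p ⊓ Mf m ⊓ Wf (r + 1)))

/-- Two-variable (Laurent) polynomials: the variable `u` is the outer one, `v` the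
inner one. -/
abbrev R2 := LaurentPolynomial (LaurentPolynomial ℝ)

/-- The monomial `a·u^pu·v^pv`. -/
def mono2 (a : ℝ) (pu pv : ℤ) : R2 :=
  LaurentPolynomial.C (LaurentPolynomial.C a * LaurentPolynomial.T pv) *
    LaurentPolynomial.T pu

/-- The Hodge–Deligne polynomial
`E(V, F_•, W^•; u, v) = Σ_{p,q} dim(Gr^F_p Gr_W^{p+q} V) u^p v^q`. -/
def E2 {V : Type} [AddCommGroup V] [Module ℝ V] (Ff Wf : ℤ → Submodule ℝ V) : R2 :=
  ∑ᶠ (p : ℤ) (q : ℤ), mono2 (grDim2 Ff Wf p (p + q)) p q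

/-- Substitution `t ↦ u·v⁻¹` into a one-variable polynomial. -/
def substUVinv (P : Polynomial ℝ) : R2 := P.sum fun k a => mono2 a k (-(k : ℤ))

/-- Substitution `t ↦ u·v` into a one-variable polynomial. -/
def substUV (P : Polynomial ℝ) : R2 := P.sum fun k a => mono2 a k k

/-- The monomial `v^n`. -/
def vpow2 (n : ℕ) : R2 := mono2 1 0 n

/-- Three-variable (Laurent) polynomials; the outermost variable is `w`. -/
abbrev R3 := LaurentPolynomial R2

/-- The monomial `a·u^pu·v^pv·w^pw`. -/
def mono3 (a : ℝ) (pu pv pw : ℤ) : R3 :=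
  LaurentPolynomial.C (mono2 a pu pv) * LaurentPolynomial.T pw

/-- The refined limit Hodge–Deligne polynomial
`E(V, F_•, W^•, M^•; u,v,w) = Σ_{p,q,r} dim(Gr^F_p Gr_M^{p+q} Gr_W^r V) u^p v^q w^r`. -/
def E3 {V : Type} [AddCommGroup V] [Module ℝ V]
    (Ff Mf Wf : ℤ → Submodule ℝ V) : R3 :=
  ∑ᶠ (p : ℤ) (q : ℤ) (r : ℤ), mono3 (grDim3 Ff Mf Wf p (p + q) r) p q r

/-- Substitution `t ↦ u·v⁻¹`. -/
def substUVinv3 (P : Polynomial ℝ) : R3 := P.sum fun k a => mono3 a k (-(k : ℤ)) 0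

/-- Substitution `t ↦ u·v`. -/
def substUV3 (P : Polynomial ℝ) : R3 := P.sum fun k a => mono3 a k k 0

/-- Substitution `t ↦ u·v·w²`. -/
def substUVW2 (P : Polynomial ℝ) : R3 := P.sum fun k a => mono3 a k k (2 * (k : ℤ))

/-- The monomial `w^n`. -/
def wpow3 (n : ℕ) : R3 := mono3 1 0 0 n

/-! ### Toric `g`- and `h`-polynomials (as defining recursions) -/

/-- `g2 σ τ` (for a face `σ ≤ τ`) is the toric `g`-polynomial of the cone `τ̄`
in the link of `σ`, i.e. of the face poset `[σ, τ]`: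
`g2 σ σ = 1`, and for `σ < τ` it is the unique polynomial of degree `< (dim τ − dim σ)/2`
with `t^{dim τ − dim σ}·(g2 σ τ)(t⁻¹) = Σ_{σ ≤ γ ≤ τ} (g2 σ γ)·(t−1)^{dim τ − dim γ}`. -/
def G2Hyp (C : Set (Set (Vec d))) (g2 : Set (Vec d) → Set (Vec d) → Polynomial ℝ) :
    Prop :=
  (∀ σ ∈ C, g2 σ σ = 1) ∧
  ∀ σ τ, σ ∈ C → τ ∈ C → IsFaceOf σ τ → σ ≠ τ →
    2 * (g2 σ τ).natDegree < coneDim τ - coneDim σ ∧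
    Polynomial.reflect (coneDim τ - coneDim σ) (g2 σ τ) =
      ∑ᶠ γ ∈ {γ | IsFaceOf γ τ ∧ IsFaceOf σ γ},
        g2 σ γ * (Polynomial.X - 1) ^ (coneDim τ - coneDim γ)

/-- `gd τ σ` (for a face `τ ≤ σ`) is the toric `g`-polynomial of the *dual* poset
`([τ, σ])* = (link_{⟨σ⟩} τ)*`. -/
def GdHyp (C : Set (Set (Vec d))) (gd : Set (Vec d) → Set (Vec d) → Polynomial ℝ) :
    Prop :=
  (∀ σ ∈ C, gd σ σ = 1) ∧
  ∀ τ σ, τ ∈ C → σ ∈ C → IsFaceOf τ σ → τ ≠ σ →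
    2 * (gd τ σ).natDegree < coneDim σ - coneDim τ ∧
    Polynomial.reflect (coneDim σ - coneDim τ) (gd τ σ) =
      ∑ᶠ γ ∈ {γ | IsFaceOf γ σ ∧ IsFaceOf τ γ},
        gd γ σ * (Polynomial.X - 1) ^ (coneDim γ - coneDim τ)

/-- `hlk σ S` is the toric `h`-polynomial of the link of the cone `σ` in the fan `S`
(for `σ` the zero cone this is the toric `h`-polynomial of `S` itself), determined
by the recursion
`t^{dim S − dim σ}·h(link_S σ; t⁻¹) = Σ_{τ ∈ S, τ ≥ σ} g(⟨τ̄⟩; t)·(t−1)^{dim S − dim τ}`. -/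
def HlkHyp (C : Set (Set (Vec d)))
    (g2 : Set (Vec d) → Set (Vec d) → Polynomial ℝ)
    (hlk : Set (Vec d) → Set (Set (Vec d)) → Polynomial ℝ) : Prop :=
  ∀ S, FaceClosedIn C S → ∀ σ ∈ S,
    Polynomial.reflect (fandim S - coneDim σ) (hlk σ S) =
      ∑ᶠ τ ∈ {τ | τ ∈ S ∧ IsFaceOf σ τ},
        g2 σ τ * (Polynomial.X - 1) ^
          ((fandim S - coneDim σ) - (coneDim τ - coneDim σ))

/-- The local `h`-polynomial `ℓ^h_{⟨σ⟩}(π⁻¹(⟨σ⟩); t)` of the fan subdivision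
`π : Sg → Δ` restricted over the cone `σ`:
`Σ_{τ ≤ σ} h(π⁻¹(⟨τ⟩); t)·(−1)^{dim σ − dim τ}·g((link_{⟨σ⟩} τ)*; t)`. -/
def ellh (Sg : Fan d) (hlk : Set (Vec d) → Set (Set (Vec d)) → Polynomial ℝ)
    (gd : Set (Vec d) → Set (Vec d) → Polynomial ℝ) (σ : Set (Vec d)) :
    Polynomial ℝ :=
  ∑ᶠ τ ∈ faces σ, ((-1 : ℝ) ^ (coneDim σ - coneDim τ)) •
    (hlk (oCone d) (preim Sg τ) * gd τ σ)

/-- The mixed `h`-polynomial `h_Δ(Σ; u, v)` of a fan subdivision `π : Sg → Δ`. -/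
def mixedh (Sg Δ : Fan d)
    (hlk : Set (Vec d) → Set (Set (Vec d)) → Polynomial ℝ)
    (gd : Set (Vec d) → Set (Vec d) → Polynomial ℝ) : R2 :=
  ∑ᶠ σ ∈ Δ.cones,
    vpow2 (fandim (preim Sg σ)) * substUVinv (ellh Sg hlk gd σ) *
      substUV (hlk σ Δ.cones)

end
/-- The subspace `𝔪·N` of a submodule `N` of the module of sections. -/
def mSmulSec {d : ℕ} (F : SheafData d) (S : Set (Set (Vec d)))
    (N : Submodule ℝ ↥(secs F S)) : Submodule ℝ ↥(secs F S) :=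
  Submodule.span ℝ {y | ∃ p ∈ mId d, ∃ z ∈ N,
    (y : ∀ σ : S, F.stalk σ.1) = fun σ => F.asmul σ.1 p ((z : ↥(secs F S)).1 σ)}

/-- Multiplication by `𝔪` maps the stalk `𝒲^{r-2}ℱ(σ)` into `𝒲^rℱ(σ)`. -/
theorem IsWeightFamily.asmul_mem {d : ℕ} {Δ : Fan d} {F : SheafData d} (hF : IsSheafOn F Δ)
    {Wk : ℤ → ∀ σ : Set (Vec d), Submodule ℝ (F.stalk σ)} (hWk : IsWeightFamily F Δ Wk)
    {σ : Set (Vec d)} (hσ : σ ∈ Δ.cones) (r : ℤ) {p : PolyA d} (hp : p ∈ mId d)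
    {z : F.stalk σ} (hz : z ∈ Wk (r - 2) σ) : F.asmul σ p z ∈ Wk r σ := by
  have hwf : Δ.cones.WellFoundedOn (· ⊂ ·) := Δ.finite.wellFoundedOn
  revert z
  refine hwf.induction
    (P := fun σ => ∀ {z : F.stalk σ}, z ∈ Wk (r - 2) σ → F.asmul σ p z ∈ Wk r σ) hσ ?_
  intro σ hσ ih z hz
  obtain ⟨h_nonpos, h_mid, h_big⟩ := hWk σ hσ r
  rcases le_or_gt r 0 with hr | hr
  · simp [h_nonpos hr]
  rcases lt_or_ge (coneDim σ : ℤ) r with hd | hd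
  · rw [h_big hd]
    exact Submodule.subset_span ⟨p, hp, z, hz, rfl⟩
  rw [h_mid hr hd]
  rintro τ ⟨hτ, hne⟩
  have hτΔ := Δ.faceClosed σ hσ τ hτ
  have hsub : τ ⊆ σ := by
    obtain ⟨w, -, rfl⟩ := hτ
    exact Set.sep_subset _ _
  rw [hF.res_asmul σ hσ τ hτ]
  refine ih τ hτΔ (hsub.ssubset_of_ne hne) ?_
  rcases le_or_gt (r - 2) 0 with hr2 | hr2
  · simp [(hWk τ hτΔ (r - 2)).1 hr2]
  · exact ((hWk σ hσ (r - 2)).2.1 hr2 (by omega) z).1 hz τ ⟨hτ, hne⟩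

/-! ## Statement 10:
Let `ℱ` be a pure sheaf on a fan `Δ`.  For every open set `U` (subfan of `Δ`) and
every integer `r`, one has `𝔪·𝒲^{r−2}ℱ(U) ⊆ 𝒲^r ℱ(U)`, where `𝔪 = (x_1, …, x_d)`
is the homogeneous maximal ideal of `A = ℝ[x_1, …, x_d]`. -/
theorem m_smul_weight_le_weight
    {d : ℕ} (Δ : Fan d) (F : SheafData d) (hF : IsPureOn F Δ)
    (Wk : ℤ → ∀ σ : Set (Vec d), Submodule ℝ (F.stalk σ))
    (hWk : IsWeightFamily F Δ Wk)
    (U : Set (Set (Vec d))) (hU : Subfan Δ U) (r : ℤ) :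
    mSmulSec F U (WSec F U Wk (r - 2)) ≤ WSec F U Wk r := by
  refine Submodule.span_le.2 ?_
  rintro y ⟨p, hp, z, hz, hy⟩ σ -
  simp only [Submodule.subtype_apply, hy]
  exact hWk.asmul_mem hF.1 (hU.1 σ.2) r hp (hz σ trivial)
end

section
/- Every morphism φ: ℱ → 𝒢 of pure sheaves on a fan Δ sends the weight sheaves into the weight sheaves: for every open set U and every integer r, φ(𝒲^rℱ(U)) ⊆ 𝒲^r𝒢(U). -/
open scoped Classical

/-- A morphism of sheaves of graded `𝒜`-modules on `Δ`: a family of graded linear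
maps on stalks commuting with the restriction maps and the `A`-action. -/
def IsSheafHom {d : ℕ} (F G : SheafData d) (Δ : Fan d)
    (φ : ∀ σ, F.stalk σ →ₗ[ℝ] G.stalk σ) : Prop :=
  (∀ σ ∈ Δ.cones, ∀ τ, IsFaceOf τ σ → ∀ x, G.res σ τ (φ σ x) = φ τ (F.res σ τ x)) ∧
  (∀ σ ∈ Δ.cones, ∀ p x, φ σ (F.asmul σ p x) = G.asmul σ p (φ σ x)) ∧
  (∀ σ ∈ Δ.cones, ∀ n, ∀ x ∈ F.deg σ n, φ σ x ∈ G.deg σ n)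

/-- A morphism of sheaves respects multiplication by the maximal ideal. -/
theorem IsSheafHom.map_mem_mSmul {d : ℕ} {F G : SheafData d} {Δ : Fan d}
    {φ : ∀ σ, F.stalk σ →ₗ[ℝ] G.stalk σ} (hφ : IsSheafHom F G Δ φ)
    {σ : Set (Vec d)} (hσ : σ ∈ Δ.cones)
    {M : Submodule ℝ (F.stalk σ)} {N : Submodule ℝ (G.stalk σ)}
    (h : ∀ x ∈ M, φ σ x ∈ N) {x : F.stalk σ} (hx : x ∈ mSmul F σ M) :
    φ σ x ∈ mSmul G σ N := by
  have hle : mSmul F σ M ≤ (mSmul G σ N).comap (φ σ) := by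
    refine Submodule.span_le.2 ?_
    rintro _ ⟨p, hp, z, hz, rfl⟩
    exact Submodule.subset_span ⟨p, hp, φ σ z, h z hz, hφ.2.1 σ hσ p z⟩
  exact hle hx

/-- A morphism of sheaves maps the stalks of the weight sheaves into each other. -/
theorem IsSheafHom.map_mem_weight {d : ℕ} {F G : SheafData d} {Δ : Fan d}
    {φ : ∀ σ, F.stalk σ →ₗ[ℝ] G.stalk σ} (hφ : IsSheafHom F G Δ φ)
    {WkF : ℤ → ∀ σ : Set (Vec d), Submodule ℝ (F.stalk σ)}
    {WkG : ℤ → ∀ σ : Set (Vec d), Submodule ℝ (G.stalk σ)}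
    (hWkF : IsWeightFamily F Δ WkF) (hWkG : IsWeightFamily G Δ WkG)
    (r : ℤ) {σ : Set (Vec d)} (hσ : σ ∈ Δ.cones) :
    ∀ x ∈ WkF r σ, φ σ x ∈ WkG r σ := by
  suffices H : ∀ (n : ℕ) (r : ℤ), r ≤ n → ∀ σ ∈ Δ.cones,
      ∀ x ∈ WkF r σ, φ σ x ∈ WkG r σ from
    H r.toNat r (Int.self_le_toNat r) σ hσ
  intro n
  induction n with
  | zero =>
    intro r hr σ hσ x _
    rw [(hWkG σ hσ r).1 (by simpa using hr)]
    trivial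
  | succ n ih =>
    intro r hr σ hσ
    refine Set.WellFoundedOn.induction (r := (· < ·))
      (P := fun σ => ∀ x ∈ WkF r σ, φ σ x ∈ WkG r σ)
      Δ.finite.wellFoundedOn hσ ?_
    intro σ hσ hfaces x hx
    rcases le_or_gt r 0 with h0 | h0
    · rw [(hWkG σ hσ r).1 h0]
      trivial
    rcases le_or_gt r (coneDim σ : ℤ) with h1 | h1
    · refine ((hWkG σ hσ r).2.1 h0 h1 _).2 fun τ hτ => ?_
      rw [hφ.1 σ hσ τ hτ.1 x]
      have hsub : τ ⊆ σ := by
        obtain ⟨w, -, rfl⟩ := hτ.1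
        exact Set.sep_subset _ _
      exact hfaces τ (Δ.faceClosed σ hσ τ hτ.1) (lt_of_le_of_ne hsub hτ.2) _
        (((hWkF σ hσ r).2.1 h0 h1 x).1 hx τ hτ)
    · rw [(hWkF σ hσ r).2.2 h1] at hx
      rw [(hWkG σ hσ r).2.2 h1]
      exact hφ.map_mem_mSmul hσ (ih (r - 2) (by push_cast at hr; omega) σ hσ) hx

/-! ## Statement 13:
Every morphism `φ : ℱ → 𝒢` of pure sheaves on a fan `Δ` sends the weight sheaves
into the weight sheaves: for every open set `U` and every integer `r`,
`φ(𝒲^r ℱ(U)) ⊆ 𝒲^r 𝒢(U)`. -/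
theorem sheafHom_maps_weight_to_weight
    {d : ℕ} (Δ : Fan d) (F G : SheafData d)
    (hF : IsPureOn F Δ) (hG : IsPureOn G Δ)
    (φ : ∀ σ, F.stalk σ →ₗ[ℝ] G.stalk σ) (hφ : IsSheafHom F G Δ φ)
    (WkF : ℤ → ∀ σ : Set (Vec d), Submodule ℝ (F.stalk σ))
    (WkG : ℤ → ∀ σ : Set (Vec d), Submodule ℝ (G.stalk σ))
    (hWkF : IsWeightFamily F Δ WkF) (hWkG : IsWeightFamily G Δ WkG)
    (U : Set (Set (Vec d))) (hU : Subfan Δ U) (r : ℤ) :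
    ∀ f ∈ WSec F U WkF r,
      (fun σ : U => φ σ.1 ((f : ↥(secs F U)).1 σ)) ∈ secs G U ∧
      (fun σ : U => φ σ.1 ((f : ↥(secs F U)).1 σ)) ∈
        Submodule.pi Set.univ (fun σ : U => WkG r σ.1) := by
  intro f hf
  refine ⟨fun σ τ hτ => ?_, fun σ _ => ?_⟩
  · rw [hφ.1 σ.1 (hU.1 σ.2) τ.1 hτ, (mem_secs F U f.1).1 f.2 σ τ hτ]
  · exact hφ.map_mem_weight hWkF hWkG r (hU.1 σ.2) _ (hf σ trivial)
end
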